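/- arXiv:2007.01533 — 2 statements merged into one kernel-verified Lean document; each statement's English description precedes it below -/
import Mathlib

section
/- (Bernshteyn–Kostochka) Let G=(V,E) be a finite simple unweighted graph and let t be an integer with t ≥ 2. If |V| ≥ (5/2)·t and |E| > (19/12)·t·(|V| − t), then there exists a subset S ⊆ V such that the induced subgraph G[S] is (t+1)-vertex-connected. -/
open Finset
open scoped Classical

noncomputable section

variable {V : Type*} [Fintype V] [DecidableEq V]

/-- The set of edges of `G` with both endpoints in `S`, i.e. the edge set `E(S)`
of the induced subgraph `G[S]`. -/
def edgesIn (G : SimpleGraph V) (S : Finset V) : Finset (Sym2 V) :=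
  Finset.univ.filter (fun e => e ∈ G.edgeSet ∧ ∀ v ∈ e, v ∈ S)

/-- The (unweighted) degree of a vertex `v` in the induced subgraph `G[S]`. -/
def ndeg (G : SimpleGraph V) (S : Finset V) (v : V) : ℕ :=
  ((edgesIn G S).filter (fun e => v ∈ e)).card

/-- `G[S]` is `k`-vertex-connected: it has at least `k+1` vertices, and deleting any set
of fewer than `k` vertices leaves a connected graph. -/
def VertexConnected (G : SimpleGraph V) (S : Finset V) (k : ℕ) : Prop :=
  k + 1 ≤ S.card ∧ ∀ D : Finset V, D ⊆ S → D.card < k →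
    (G.induce ((S \ D : Finset V) : Set V)).Connected

/-- Number of ordered adjacent pairs in `U × W`, as a real number. -/
def dd (G : SimpleGraph V) (U W : Finset V) : ℝ :=
  ∑ u ∈ U, ∑ w ∈ W, if G.Adj u w then (1 : ℝ) else 0

lemma dd_union_left (G : SimpleGraph V) {U U' : Finset V} (W : Finset V) (h : Disjoint U U') :
    dd G (U ∪ U') W = dd G U W + dd G U' W := by
  unfold dd
  rw [Finset.sum_union h]

lemma dd_union_right (G : SimpleGraph V) {U U' : Finset V} (W : Finset V) (h : Disjoint U U') :
    dd G W (U ∪ U') = dd G W U + dd G W U' := by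
  unfold dd
  rw [← Finset.sum_add_distrib]
  exact Finset.sum_congr rfl fun w _ => Finset.sum_union h

lemma dd_symm (G : SimpleGraph V) (U W : Finset V) : dd G U W = dd G W U := by
  unfold dd
  rw [Finset.sum_comm]
  simp only [G.adj_comm]

lemma dd_zero (G : SimpleGraph V) {U W : Finset V} (h : ∀ u ∈ U, ∀ w ∈ W, ¬ G.Adj u w) :
    dd G U W = 0 := by
  unfold dd
  exact Finset.sum_eq_zero fun u hu => Finset.sum_eq_zero fun w hw => by simp [h u hu w hw]

lemma dd_le_of (G : SimpleGraph V) {U W : Finset V} {c : ℝ} (h : ∀ u ∈ U, dd G {u} W ≤ c) :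
    dd G U W ≤ U.card * c := by
  unfold dd at *
  rw [← nsmul_eq_mul]
  apply Finset.sum_le_card_nsmul
  intro u hu
  simpa using h u hu

lemma dd_single_le (G : SimpleGraph V) (u : V) (W : Finset V) : dd G {u} W ≤ W.card := by
  unfold dd
  rw [Finset.sum_singleton]
  have : (W.card : ℝ) = ∑ w ∈ W, (1 : ℝ) := by simp
  rw [this]
  exact Finset.sum_le_sum fun w _ => by split_ifs <;> norm_num

lemma dd_le (G : SimpleGraph V) (U W : Finset V) : dd G U W ≤ U.card * W.card :=
  dd_le_of G fun u _ => dd_single_le G u W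

lemma dd_self_le (G : SimpleGraph V) (U : Finset V) : dd G U U ≤ U.card * (U.card - 1) := by
  apply dd_le_of
  intro u hu
  have h1 : U = {u} ∪ U.erase u := by
    ext x; by_cases hx : x = u <;> simp [hx, hu]
  have h2 : Disjoint {u} (U.erase u) := by simp
  have h3 : dd G {u} U = dd G {u} {u} + dd G {u} (U.erase u) := by
    conv_lhs => rw [h1]
    exact dd_union_right G {u} h2
  rw [h3, dd_zero G (U := {u}) (W := {u}) (by simp)]
  have h4 := dd_single_le G u (U.erase u)
  have h5 : ((U.erase u).card : ℝ) = U.card - 1 := by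
    rw [Finset.card_erase_of_mem hu, Nat.cast_sub (Finset.card_pos.2 ⟨u, hu⟩)]; simp
  linarith

lemma dd_inter_split (G : SimpleGraph V) (U : Finset V) {X P D Q : Finset V} (hX : X ⊆ P ∪ D ∪ Q)
    (hPD : Disjoint P D) (hPQ : Disjoint P Q) (hDQ : Disjoint D Q) :
    dd G U X = dd G U (X ∩ P) + dd G U (X ∩ D) + dd G U (X ∩ Q) := by
  have h1 : X = ((X ∩ P) ∪ (X ∩ D)) ∪ (X ∩ Q) := by
    rw [← Finset.inter_union_distrib_left, ← Finset.inter_union_distrib_left]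
    exact (Finset.inter_eq_left.2 hX).symm
  conv_lhs => rw [h1]
  rw [dd_union_right, dd_union_right]
  · exact hPD.mono inter_subset_right inter_subset_right
  · rw [Finset.disjoint_union_left]
    exact ⟨hPQ.mono inter_subset_right inter_subset_right,
      hDQ.mono inter_subset_right inter_subset_right⟩

lemma card_inter_split {X P D Q : Finset V} (hX : X ⊆ P ∪ D ∪ Q)
    (hPD : Disjoint P D) (hPQ : Disjoint P Q) (hDQ : Disjoint D Q) :
    (X.card : ℝ) = (X ∩ P).card + (X ∩ D).card + (X ∩ Q).card := by
  have h1 : X = ((X ∩ P) ∪ (X ∩ D)) ∪ (X ∩ Q) := by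
    rw [← Finset.inter_union_distrib_left, ← Finset.inter_union_distrib_left]
    exact (Finset.inter_eq_left.2 hX).symm
  conv_lhs => rw [h1]
  rw [Finset.card_union_of_disjoint, Finset.card_union_of_disjoint]
  · push_cast; ring
  · exact hPD.mono inter_subset_right inter_subset_right
  · rw [Finset.disjoint_union_left]
    exact ⟨hPQ.mono inter_subset_right inter_subset_right,
      hDQ.mono inter_subset_right inter_subset_right⟩

/-- `P, D, Q` is a separation of `G[W]` of order exactly `k`. -/
structure IsSep (G : SimpleGraph V) (k : ℕ) (W P D Q : Finset V) : Prop where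
  un : W = P ∪ D ∪ Q
  pd : Disjoint P D
  pq : Disjoint P Q
  dq : Disjoint D Q
  cD : D.card = k
  nP : P.Nonempty
  nQ : Q.Nonempty
  na : ∀ x ∈ P, ∀ y ∈ Q, ¬ G.Adj x y

lemma IsSep.symm {G : SimpleGraph V} {k : ℕ} {W P D Q : Finset V} (h : IsSep G k W P D Q) :
    IsSep G k W Q D P where
  un := by rw [h.un]; ext x; simp; tauto
  pd := h.dq.symm
  pq := h.pq.symm
  dq := h.pd.symm
  cD := h.cD
  nP := h.nQ
  nQ := h.nP
  na := fun x hx y hy hxy => h.na y hy x hx hxy.symm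

lemma IsSep.card {G : SimpleGraph V} {k : ℕ} {W P D Q : Finset V} (h : IsSep G k W P D Q) :
    W.card = P.card + k + Q.card := by
  rw [h.un, Finset.card_union_of_disjoint, Finset.card_union_of_disjoint h.pd, h.cD]
  rw [Finset.disjoint_union_left]; exact ⟨h.pq, h.dq⟩

lemma exists_sep (G : SimpleGraph V) (k : ℕ) (H : ¬ ∃ S : Finset V, VertexConnected G S (k + 1))
    (W : Finset V) (hW : k + 2 ≤ W.card) : ∃ P D Q, IsSep G k W P D Q := by
  have h1 : ¬ VertexConnected G W (k + 1) := fun h => H ⟨W, h⟩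
  unfold VertexConnected at h1
  push Not at h1
  obtain ⟨D₀, hD₀W, hD₀k, hnc⟩ := h1 (by omega)
  have hne : (W \ D₀).Nonempty := by
    rw [← Finset.card_pos]
    have := Finset.le_card_sdiff D₀ W
    omega
  have : Nonempty (((W \ D₀ : Finset V) : Set V)) := hne.to_subtype
  rw [SimpleGraph.connected_iff] at hnc
  have hnp : ¬ (G.induce ((W \ D₀ : Finset V) : Set V)).Preconnected := fun h => hnc ⟨h, this⟩
  unfold SimpleGraph.Preconnected at hnp
  push Not at hnp
  obtain ⟨u, v, huv⟩ := hnp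
  set I := G.induce ((W \ D₀ : Finset V) : Set V) with hI
  let P₀ : Finset V := (W \ D₀).filter (fun x => ∃ hx : x ∈ ((W \ D₀ : Finset V) : Set V), I.Reachable u ⟨x, hx⟩)
  let Q₀ : Finset V := (W \ D₀).filter (fun x => ¬ ∃ hx : x ∈ ((W \ D₀ : Finset V) : Set V), I.Reachable u ⟨x, hx⟩)
  have huP : (u : V) ∈ P₀ := by
    simp only [P₀, Finset.mem_filter]
    exact ⟨u.2, u.2, SimpleGraph.Reachable.refl _⟩
  have hvQ : (v : V) ∈ Q₀ := by
    simp only [Q₀, Finset.mem_filter]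
    exact ⟨v.2, fun ⟨_, h⟩ => huv h⟩
  have hna : ∀ x ∈ P₀, ∀ y ∈ Q₀, ¬ G.Adj x y := by
    intro x hx y hy hxy
    simp only [P₀, Q₀, Finset.mem_filter] at hx hy
    obtain ⟨_, hx1, hx2⟩ := hx
    obtain ⟨hy1, hy2⟩ := hy
    refine hy2 ⟨hy1, hx2.trans (SimpleGraph.Adj.reachable ?_)⟩
    simpa [hI] using hxy
  have huW : (u : V) ∈ W \ D₀ := u.2
  have hvW : (v : V) ∈ W \ D₀ := v.2
  have huv' : (u : V) ≠ v := fun h => huv (by rw [Subtype.ext h])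
  rw [Finset.mem_sdiff] at huW hvW
  have hsub : D₀ ⊆ (W.erase u).erase v := by
    intro x hx
    simp only [Finset.mem_erase]
    exact ⟨fun h => hvW.2 (h ▸ hx), fun h => huW.2 (h ▸ hx), hD₀W hx⟩
  obtain ⟨D, hD1, hD2, hD3⟩ := Finset.exists_subsuperset_card_eq (n := k) hsub (by omega) (by
    rw [Finset.card_erase_of_mem (by simp [huv'.symm, hvW.1]), Finset.card_erase_of_mem huW.1]
    omega)
  refine ⟨P₀ \ D, D, Q₀ \ D, ?_, Finset.sdiff_disjoint, ?_, Finset.disjoint_sdiff, hD3,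
    ⟨u, ?_⟩, ⟨v, ?_⟩, ?_⟩
  · ext x
    have a1 : x ∈ D → x ∈ W := fun h => by
      have := hD2 h
      simp at this; tauto
    have a2 : x ∈ D₀ → x ∈ D := fun h => hD1 h
    have a3 : x ∈ W \ D₀ ↔ x ∈ P₀ ∨ x ∈ Q₀ := by
      simp only [P₀, Q₀, Finset.mem_filter]; tauto
    simp only [Finset.mem_union, Finset.mem_sdiff] at *
    tauto
  · exact (Finset.disjoint_filter_filter_not _ _ _).mono sdiff_subset sdiff_subset
  · rw [Finset.mem_sdiff]
    refine ⟨huP, fun h => ?_⟩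
    have := hD2 h
    simp at this
  · rw [Finset.mem_sdiff]
    refine ⟨hvQ, fun h => ?_⟩
    have := hD2 h
    simp at this
  · intro x hx y hy
    exact hna x (sdiff_subset hx) y (sdiff_subset hy)

lemma dd_sep {G : SimpleGraph V} {k : ℕ} {W P D Q : Finset V} (h : IsSep G k W P D Q) :
    dd G W W = dd G (P ∪ D) (P ∪ D) + (dd G Q Q + 2 * dd G Q D) := by
  have h1 : Disjoint (P ∪ D) Q := by
    rw [Finset.disjoint_union_left]; exact ⟨h.pq, h.dq⟩
  rw [h.un, dd_union_left G _ h1, dd_union_right G _ h1, dd_union_right G _ h1,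
    dd_symm G (P ∪ D) Q, dd_union_right G Q h.pd, dd_zero G h.symm.na]
  ring

/-- Dense-range bound: at least `((w-k)²-1)/3` non-edges. -/
lemma small_bound (G : SimpleGraph V) (k : ℕ)
    (H : ¬ ∃ S : Finset V, VertexConnected G S (k + 1)) :
    ∀ n : ℕ, ∀ W : Finset V, W.card = n → k + 1 ≤ n →
      dd G W W ≤ (n : ℝ) * (n - 1) - 2 / 3 * (((n : ℝ) - k) ^ 2 - 1) := by
  intro n
  induction n using Nat.strong_induction_on with
  | _ n ih =>
  intro W hW hn
  rcases Nat.eq_or_lt_of_le hn with h | h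
  · have := dd_self_le G W
    rw [hW] at this
    have e : (n : ℝ) - k = 1 := by rw [← h]; push_cast; ring
    rw [e]; linarith
  · have key : ∀ P D Q, IsSep G k W P D Q → Q.card ≤ P.card →
      dd G W W ≤ (n : ℝ) * (n - 1) - 2 / 3 * (((n : ℝ) - k) ^ 2 - 1) := by
      intro P D Q hs hle
      have hP := hs.nP.card_pos
      have hQ := hs.nQ.card_pos
      have hc := hs.card
      have hPD : (P ∪ D).card = P.card + k := by
        rw [Finset.card_union_of_disjoint hs.pd, hs.cD]
      have h1 := ih (P.card + k) (by omega) (P ∪ D) hPD (by omega)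
      have h2 := dd_self_le G Q
      have h3 := dd_le G Q D
      rw [hs.cD] at h3
      rw [dd_sep hs]
      have hn' : (n : ℝ) = P.card + k + Q.card := by rw [← hW, hc]; push_cast; ring
      have hle' : (Q.card : ℝ) ≤ P.card := by exact_mod_cast hle
      have hQ' : (0 : ℝ) ≤ Q.card := by positivity
      rw [hn']
      push_cast at h1
      nlinarith [mul_nonneg hQ' (sub_nonneg.2 hle')]
    obtain ⟨P, D, Q, hs⟩ := exists_sep G k H W (by omega)
    rcases le_total Q.card P.card with h' | h'
    · exact key P D Q hs h'
    · exact key Q D P hs.symm h'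

/-- Arithmetic part of the loss lemma. -/
lemma loss_arith {k a p xP xD xQ sP sD sQ : ℝ} (hk : 0 ≤ k) (hp : 0 ≤ p)
    (hxP : 0 ≤ xP) (hxQ : 0 ≤ xQ) (hsP : 0 ≤ sP) (hsQ : 0 ≤ sQ) (hsD : 0 ≤ sD) (hxD : 0 ≤ xD)
    (ha : k ≤ a)
    (hx : a = xP + xD + xQ) (hs : k - p = sP + sD + sQ) (hD : xD + sD = k)
    (h1 : 7 / 12 * k - p ≤ xP + sP) (h2 : 7 / 12 * k - p ≤ xQ + sQ) (hp7 : p ≤ 7 / 12 * k) :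
    7 / 12 * k * (a - k) ≤ p * (a - k) + xP * xQ + xP * sQ + xQ * sP ∨
    (p ≤ k / 6 ∧ 7 / 6 * k ≤ a + p ∧
      7 / 12 * a * k - 85 / 144 * k ^ 2 + p * k / 12 - p ^ 2 / 4 ≤
        p * (a - k) + xP * xQ + xP * sQ + xQ * sP) := by
  set al := 7 / 12 * k - p with hal
  have hxx : a - k ≤ xP + xQ := by linarith
  have hal0 : 0 ≤ al := by linarith
  by_cases c1 : al ≤ sQ
  · left
    have q1 := mul_nonneg (sub_nonneg.2 c1) hxP
    have q2 := mul_nonneg (sub_nonneg.2 h1) hxQ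
    have q3 := mul_nonneg hal0 (sub_nonneg.2 hxx)
    have q4 : p * (a - k) + xP * xQ + xP * sQ + xQ * sP - 7 / 12 * k * (a - k) =
      (sQ - al) * xP + (xP + sP - al) * xQ + al * (xP + xQ - (a - k)) := by rw [hal]; ring
    linarith
  by_cases c2 : al ≤ sP
  · left
    have q1 := mul_nonneg (sub_nonneg.2 c2) hxQ
    have q2 := mul_nonneg (sub_nonneg.2 h2) hxP
    have q3 := mul_nonneg hal0 (sub_nonneg.2 hxx)
    have q4 : p * (a - k) + xP * xQ + xP * sQ + xQ * sP - 7 / 12 * k * (a - k) =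
      (sP - al) * xQ + (xQ + sQ - al) * xP + al * (xP + xQ - (a - k)) := by rw [hal]; ring
    linarith
  push Not at c1 c2
  have hsum : (xP + sP) + (xQ + sQ) = a - p := by linarith
  have hprod : al * (a - p - al) ≤ (xP + sP) * (xQ + sQ) := by
    have q1 := mul_nonneg (sub_nonneg.2 h1) (sub_nonneg.2 h2)
    rw [← hsum]
    linarith [show (xP + sP - al) * (xQ + sQ - al) =
      (xP + sP) * (xQ + sQ) - al * (xP + sP + (xQ + sQ) - al) by ring]
  have e1 : p * (a - k) + xP * xQ + xP * sQ + xQ * sP =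
      p * (a - k) + (xP + sP) * (xQ + sQ) - sP * sQ := by ring
  by_cases c3 : p ≤ k / 6
  · right
    refine ⟨c3, by linarith, ?_⟩
    have : sP * sQ ≤ (k - p) ^ 2 / 4 := by 
      have h5 : (sP + sQ) ^ 2 ≤ (k - p) ^ 2 := pow_le_pow_left₀ (by linarith) (by linarith) 2
      have h6 := sq_nonneg (sP - sQ)
      linarith [show (sP + sQ) ^ 2 - (sP - sQ) ^ 2 = 4 * (sP * sQ) by ring]
    have e2 : p * (a - k) + al * (a - p - al) - (k - p) ^ 2 / 4 =
        7 / 12 * a * k - 85 / 144 * k ^ 2 + p * k / 12 - p ^ 2 / 4 := by rw [hal]; ring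
    linarith
  · left
    push Not at c3
    have : sP * sQ ≤ al * al := mul_le_mul c2.le c1.le hsQ hal0
    have e2 : p * (a - k) + al * (a - p - al) - al * al - 7 / 12 * k * (a - k) =
        al * (p - k / 6) := by rw [hal]; ring
    have e3 := mul_nonneg hal0 (sub_nonneg.2 c3.le)
    linarith

lemma loss (G : SimpleGraph V) (k : ℕ) (hk : 2 ≤ k)
    (H : ¬ ∃ S : Finset V, VertexConnected G S (k + 1)) (X S : Finset V) (hXS : Disjoint X S)
    (hS : S.card = k) (hX : k + 1 ≤ X.card)
    (hdeg : ∀ x ∈ X, 19 / 12 * (k : ℝ) < dd G {x} (X ∪ S)) :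
    ∃ L : ℝ, dd G X X + 2 * dd G X S ≤ (X.card : ℝ) * (X.card - 1) + 2 * X.card * k - 2 * L ∧
      (7 / 12 * (k : ℝ) * (X.card - k) ≤ L ∨ ∃ p : ℝ, 0 ≤ p ∧ p ≤ (k : ℝ) / 6 ∧
        7 / 6 * (k : ℝ) ≤ X.card + p ∧
        7 / 12 * X.card * (k : ℝ) - 85 / 144 * (k : ℝ) ^ 2 + p * k / 12 - p ^ 2 / 4 ≤ L) := by
  obtain ⟨S', hS', hmin⟩ := Finset.exists_min_image
    (S.powerset.filter (fun S' => ∀ s ∈ S \ S', dd G {s} X ≤ k)) Finset.card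
    ⟨S, by simp; tauto⟩
  simp only [Finset.mem_filter, Finset.mem_powerset] at hS' hmin
  obtain ⟨hsub, hpeel⟩ := hS'
  have hSS : S = S' ∪ (S \ S') := (Finset.union_sdiff_of_subset hsub).symm
  have hdS : Disjoint S' (S \ S') := Finset.disjoint_sdiff
  have hcS : S'.card + (S \ S').card = k := by
    rw [← hS, ← Finset.card_union_of_disjoint hdS, ← hSS]
  set S₀ := S \ S' with hS₀
  have hcS' : (S'.card : ℝ) + S₀.card = k := by exact_mod_cast hcS
  have hXk : (k : ℝ) + 1 ≤ X.card := by exact_mod_cast hX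
  have e1 : dd G X S = dd G X S' + dd G X S₀ := by
    conv_lhs => rw [hSS]
    exact dd_union_right G X hdS
  have e2 : dd G X S₀ ≤ S₀.card * k := by
    rw [dd_symm]; exact dd_le_of G hpeel
  have hk0 : (0 : ℝ) ≤ k := by positivity
  have hk2 : (2 : ℝ) ≤ k := by exact_mod_cast hk
  have hp0 : (0 : ℝ) ≤ S₀.card := Nat.cast_nonneg _
  by_cases hp : 7 / 12 * (k : ℝ) ≤ S₀.card
  · refine ⟨S₀.card * (X.card - k), ?_, Or.inl ?_⟩
    · have h1 := dd_self_le G X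
      have h2 := dd_le G X S'
      have : (S'.card : ℝ) = k - S₀.card := by linarith
      rw [this] at h2
      nlinarith
    · apply mul_le_mul_of_nonneg_right hp; linarith
  push Not at hp
  have hXS' : Disjoint X S' := hXS.mono_right hsub
  have hcard : k + 2 ≤ (X ∪ S').card := by
    rw [Finset.card_union_of_disjoint hXS']
    have : (k : ℝ) + 1 < X.card + S'.card := by linarith
    have : k + 1 < X.card + S'.card := by exact_mod_cast this
    omega
  -- properties of either side of a separation
  have side : ∀ P D Q, IsSep G k (X ∪ S') P D Q → 7 / 12 * (k : ℝ) - S₀.card ≤ P.card := by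
    intro P D Q hs
    have hXsub : X ⊆ P ∪ D ∪ Q := by rw [← hs.un]; exact Finset.subset_union_left
    have hne : (X ∩ P).Nonempty := by
      by_contra hemp
      rw [Finset.not_nonempty_iff_eq_empty] at hemp
      have hPS : P ⊆ S' := by
        intro x hx
        have h1 : x ∈ X ∪ S' := by rw [hs.un]; simp [hx]
        rcases Finset.mem_union.1 h1 with h | h
        · exfalso
          have : x ∈ X ∩ P := by simp [h, hx]
          rw [hemp] at this; simp at this
        · exact h
      have := hmin (S' \ P) ⟨Finset.sdiff_subset.trans hsub, ?_⟩
      · rw [Finset.card_sdiff_of_subset hPS] at this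
        have h1 := hs.nP.card_pos
        have h2 := Finset.card_le_card hPS
        omega
      · intro s hsm
        by_cases hsP : s ∈ P
        · rw [dd_inter_split G {s} hXsub hs.pd hs.pq hs.dq, hemp,
            dd_zero G (U := {s}) (W := ∅) (by simp),
            dd_zero G (U := {s}) (W := X ∩ Q) (by
              intro u hu w hw
              rw [Finset.mem_singleton] at hu
              subst hu
              exact hs.na u hsP w (Finset.mem_inter.1 hw).2)]
          have h1 := dd_single_le G s (X ∩ D)
          have h2 : ((X ∩ D).card : ℝ) ≤ k := by
            rw [← hs.cD]; exact_mod_cast Finset.card_le_card Finset.inter_subset_right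
          linarith
        · apply hpeel
          simp only [hS₀, Finset.mem_sdiff] at hsm ⊢
          tauto
    obtain ⟨x, hx⟩ := hne
    rw [Finset.mem_inter] at hx
    have h1 := hdeg x hx.1
    have h2 : X ∪ S = (X ∪ S') ∪ S₀ := by
      conv_lhs => rw [hSS]
      rw [Finset.union_assoc]
    have h3 : Disjoint (X ∪ S') S₀ := by
      rw [Finset.disjoint_union_left]
      exact ⟨hXS.mono_right Finset.sdiff_subset, hdS⟩
    rw [h2, dd_union_right G _ h3, hs.un, dd_union_right G _ (by
      rw [Finset.disjoint_union_left]; exact ⟨hs.pq, hs.dq⟩), dd_union_right G _ hs.pd,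
      dd_zero G (U := {x}) (W := Q) (by
        intro u hu w hw
        rw [Finset.mem_singleton] at hu
        subst hu
        exact hs.na u hx.2 w hw)] at h1
    have h4 := dd_single_le G x P
    have h5 := dd_single_le G x D
    have h6 := dd_single_le G x S₀
    rw [hs.cD] at h5
    linarith
  obtain ⟨P, D, Q, hs⟩ := exists_sep G k H _ hcard
  have sideP := side P D Q hs
  have sideQ := side Q D P hs.symm
  have hXsub : X ⊆ P ∪ D ∪ Q := by rw [← hs.un]; exact Finset.subset_union_left
  have hSsub : S' ⊆ P ∪ D ∪ Q := by rw [← hs.un]; exact Finset.subset_union_right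
  have cX := card_inter_split hXsub hs.pd hs.pq hs.dq
  have cS := card_inter_split hSsub hs.pd hs.pq hs.dq
  have cc : ∀ Z ⊆ X ∪ S', (Z.card : ℝ) = (X ∩ Z).card + (S' ∩ Z).card := by
    intro Z hZ
    have h1 : Z = (X ∩ Z) ∪ (S' ∩ Z) := by
      rw [← Finset.union_inter_distrib_right]; exact (Finset.inter_eq_right.2 hZ).symm
    conv_lhs => rw [h1]
    rw [Finset.card_union_of_disjoint
      (hXS'.mono Finset.inter_subset_left Finset.inter_subset_left)]
    push_cast; ring
  have cP := cc P (by rw [hs.un]; intro x hx; simp [hx])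
  have cD := cc D (by rw [hs.un]; intro x hx; simp [hx])
  have cQ := cc Q (by rw [hs.un]; intro x hx; simp [hx])
  rw [hs.cD] at cD
  have z1 : ∀ U W : Finset V, dd G (U ∩ P) (W ∩ Q) = 0 := fun U W =>
    dd_zero G fun u hu w hw => hs.na u (Finset.mem_inter.1 hu).2 w (Finset.mem_inter.1 hw).2
  have z2 : ∀ U W : Finset V, dd G (U ∩ Q) (W ∩ P) = 0 := fun U W => by rw [dd_symm, z1]
  have ex : ∀ U ⊆ P ∪ D ∪ Q, ∀ W ⊆ P ∪ D ∪ Q, dd G U W =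
      dd G (U ∩ P) (W ∩ P) + dd G (U ∩ P) (W ∩ D) + dd G (U ∩ D) (W ∩ P) + dd G (U ∩ D) (W ∩ D)
      + dd G (U ∩ D) (W ∩ Q) + dd G (U ∩ Q) (W ∩ D) + dd G (U ∩ Q) (W ∩ Q) := by
    intro U hU W hW
    rw [dd_inter_split G U hW hs.pd hs.pq hs.dq, dd_symm G U, dd_symm G U, dd_symm G U,
      dd_inter_split G _ hU hs.pd hs.pq hs.dq, dd_inter_split G _ hU hs.pd hs.pq hs.dq,
      dd_inter_split G _ hU hs.pd hs.pq hs.dq]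
    simp only [dd_symm G (W ∩ _) _, z1, z2]
    ring
  have bXX : dd G X X ≤ (X.card : ℝ) * (X.card - 1) - 2 * ((X ∩ P).card * (X ∩ Q).card) := by
    rw [ex X hXsub X hXsub, cX]
    nlinarith [dd_self_le G (X ∩ P), dd_self_le G (X ∩ D), dd_self_le G (X ∩ Q),
      dd_le G (X ∩ P) (X ∩ D), dd_le G (X ∩ D) (X ∩ P), dd_le G (X ∩ D) (X ∩ Q),
      dd_le G (X ∩ Q) (X ∩ D)]
  have bXS : dd G X S' ≤ (X.card : ℝ) * S'.card - (X ∩ P).card * (S' ∩ Q).card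
      - (X ∩ Q).card * (S' ∩ P).card := by
    rw [ex X hXsub S' hSsub, cX, cS]
    nlinarith [dd_le G (X ∩ P) (S' ∩ P), dd_le G (X ∩ D) (S' ∩ D), dd_le G (X ∩ Q) (S' ∩ Q),
      dd_le G (X ∩ P) (S' ∩ D), dd_le G (X ∩ D) (S' ∩ P), dd_le G (X ∩ D) (S' ∩ Q),
      dd_le G (X ∩ Q) (S' ∩ D)]
  refine ⟨S₀.card * (X.card - k) + (X ∩ P).card * (X ∩ Q).card + (X ∩ P).card * (S' ∩ Q).card
    + (X ∩ Q).card * (S' ∩ P).card, ?_, ?_⟩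
  · have : (S'.card : ℝ) = k - S₀.card := by linarith
    rw [this] at bXS
    rw [e1]
    nlinarith
  · rcases loss_arith (k := k) (a := X.card) (p := S₀.card) (xP := (X ∩ P).card)
      (xD := (X ∩ D).card) (xQ := (X ∩ Q).card) (sP := (S' ∩ P).card) (sD := (S' ∩ D).card)
      (sQ := (S' ∩ Q).card) hk0 hp0 (Nat.cast_nonneg _) (Nat.cast_nonneg _) (Nat.cast_nonneg _)
      (Nat.cast_nonneg _) (Nat.cast_nonneg _) (Nat.cast_nonneg _) (by linarith) cX (by linarith) (by linarith)
      (by linarith) (by linarith) hp.le with h | ⟨h1, h2, h3⟩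
    · exact Or.inl h
    · exact Or.inr ⟨_, hp0, h1, h2, h3⟩

/-- Final arithmetic, one side large: edges meeting `X` are at most `19/12 k |X|`. -/
lemma arith_i {k a L : ℝ} (hk : 0 ≤ k) (ha : 7 / 6 * k ≤ a) (ha2 : a ≤ 3 / 2 * k)
    (h : 7 / 12 * k * (a - k) ≤ L ∨ ∃ p : ℝ, 0 ≤ p ∧ p ≤ k / 6 ∧ 7 / 6 * k ≤ a + p ∧
        7 / 12 * a * k - 85 / 144 * k ^ 2 + p * k / 12 - p ^ 2 / 4 ≤ L) :
    a * a + 2 * a * k - 2 * L ≤ 19 / 6 * k * a := by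
  have h0 := mul_nonneg (sub_nonneg.2 ha) (sub_nonneg.2 ha2)
  rcases h with h | ⟨p, hp, hp2, hap, h⟩
  · nlinarith
  · nlinarith [mul_nonneg hp (sub_nonneg.2 hp2)]

/-- Final arithmetic, both sides small. -/
lemma arith_ii {k a b L : ℝ} (hk : 0 ≤ k) (ha : k ≤ a) (hab : a ≤ b) (hb : b ≤ 3 / 2 * k)
    (h : 7 / 12 * k * (a - k) ≤ L ∨ ∃ p : ℝ, 0 ≤ p ∧ p ≤ k / 6 ∧ 7 / 6 * k ≤ a + p ∧
        7 / 12 * a * k - 85 / 144 * k ^ 2 + p * k / 12 - p ^ 2 / 4 ≤ L) :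
    a * a + 2 * a * k - 2 * L + ((k + b) ^ 2 - 2 / 3 * b ^ 2) ≤ 19 / 6 * k * (a + b) := by
  have ha2 : a ≤ 3 / 2 * k := hab.trans hb
  have hbb : 2 * b ^ 2 - 7 * b * k ≤ 2 * a ^ 2 - 7 * a * k := by
    nlinarith [mul_nonneg (sub_nonneg.2 hab) (show 0 ≤ 7 * k - 2 * (a + b) by linarith)]
  have h0 := mul_nonneg (sub_nonneg.2 ha) (sub_nonneg.2 ha2)
  rcases h with h | ⟨p, hp, hp2, hap, h⟩
  · nlinarith [mul_nonneg hk (sub_nonneg.2 ha)]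
  · have h1 := mul_nonneg hp (sub_nonneg.2 hp2)
    have h2 := mul_nonneg (sub_nonneg.2 hap) (sub_nonneg.2 ha2)
    have h3 := mul_nonneg hk (sub_nonneg.2 ha)
    have h4 := mul_nonneg hk (sub_nonneg.2 hap)
    have h5 := mul_nonneg hk (sub_nonneg.2 ha2)
    have h6 := mul_nonneg hk hp
    have h7 := mul_nonneg hk (sub_nonneg.2 hp2)
    have h8 := mul_nonneg (sub_nonneg.2 ha) hp
    have h9 := mul_nonneg (sub_nonneg.2 ha2) (sub_nonneg.2 hp2)
    nlinarith

lemma arith_iii {k a b : ℝ} (hk : 0 ≤ k) (ha0 : 0 ≤ a) (ha : a ≤ k) (hab : 2 * k ≤ a + b)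
    (hb : b ≤ 3 / 2 * k) :
    a * a + 2 * a * k + ((k + b) ^ 2 - 2 / 3 * b ^ 2) ≤ 19 / 6 * k * (a + b) := by
  nlinarith [mul_nonneg ha0 (sub_nonneg.2 ha),
    mul_nonneg (sub_nonneg.2 hab) (show 0 ≤ 3 * k + 2 * a - 2 * b by linarith),
    mul_nonneg (sub_nonneg.2 hab) (show 0 ≤ 7 * k - 2 * (2 * k - a + b) by linarith)]

lemma main_bound (G : SimpleGraph V) (k : ℕ) (hk : 2 ≤ k)
    (H : ¬ ∃ S : Finset V, VertexConnected G S (k + 1)) :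
    ∀ n : ℕ, ∀ W : Finset V, W.card = n → 5 * k ≤ 2 * n →
      dd G W W ≤ 19 / 6 * (k : ℝ) * ((n : ℝ) - k) := by
  intro n
  induction n using Nat.strong_induction_on with
  | _ n ih =>
  intro W hW hn
  have hk0 : (0 : ℝ) ≤ k := by positivity
  have hk2 : (2 : ℝ) ≤ k := by exact_mod_cast hk
  have hn5 : 5 * (k : ℝ) ≤ 2 * n := by exact_mod_cast hn
  by_cases h3 : n ≤ 3 * k
  · have h := small_bound G k H n W hW (by omega)
    have h3' : (n : ℝ) ≤ 3 * k := by exact_mod_cast h3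
    nlinarith [mul_nonneg (sub_nonneg.2 hn5) (sub_nonneg.2 h3')]
  push Not at h3
  have h3' : 3 * (k : ℝ) ≤ n := by exact_mod_cast h3.le
  by_cases hd : ∃ v ∈ W, dd G {v} W ≤ 19 / 12 * (k : ℝ)
  · obtain ⟨v, hv, hdv⟩ := hd
    have h1 : W = {v} ∪ W.erase v := by
      ext x; by_cases hx : x = v <;> simp [hx, hv]
    have h2 : Disjoint {v} (W.erase v) := by simp
    have hc : (W.erase v).card = n - 1 := by rw [Finset.card_erase_of_mem hv, hW]
    have hi := ih (n - 1) (by omega) _ hc (by omega)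
    rw [Nat.cast_sub (by omega)] at hi
    have e1 : dd G {v} W = dd G {v} {v} + dd G {v} (W.erase v) := by
      conv_lhs => rw [h1]
      exact dd_union_right G _ h2
    have e2 : dd G W W = dd G {v} {v} + dd G {v} (W.erase v) +
        (dd G {v} (W.erase v) + dd G (W.erase v) (W.erase v)) := by
      conv_lhs => rw [h1]
      rw [dd_union_left G _ h2, dd_union_right G _ h2, dd_union_right G _ h2,
        dd_symm G (W.erase v) {v}]
    rw [dd_zero G (U := {v}) (W := {v}) (by simp)] at e1 e2
    push_cast at hi
    nlinarith
  push Not at hd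
  have key : ∀ P D Q, IsSep G k W P D Q → Q.card ≤ P.card →
      dd G W W ≤ 19 / 6 * (k : ℝ) * ((n : ℝ) - k) := by
    intro P D Q hs hle
    have hQ := hs.nQ.card_pos
    have hc := hs.card
    have hPD : (P ∪ D).card = P.card + k := by
      rw [Finset.card_union_of_disjoint hs.pd, hs.cD]
    have hQD : (Q ∪ D).card = Q.card + k := by
      rw [Finset.card_union_of_disjoint hs.dq.symm, hs.cD]
    have hn' : (n : ℝ) = P.card + k + Q.card := by rw [← hW, hc]; push_cast; ring
    have hle' : (Q.card : ℝ) ≤ P.card := by exact_mod_cast hle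
    have hQ0 : (0 : ℝ) ≤ Q.card := by positivity
    have hQ1 : (1 : ℝ) ≤ Q.card := by exact_mod_cast hQ
    have triv := dd_self_le G Q
    have triv2 := dd_le G Q D
    rw [hs.cD] at triv2
    rw [dd_sep hs]
    have hdeg : ∀ x ∈ Q, 19 / 12 * (k : ℝ) < dd G {x} (Q ∪ D) := by
      intro x hx
      have h1 := hd x (by rw [hs.un]; simp [hx])
      have h2 : W = (Q ∪ D) ∪ P := hs.symm.un
      rw [h2, dd_union_right G _ (by
        rw [Finset.disjoint_union_left]; exact ⟨hs.pq.symm, hs.pd.symm⟩),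
        dd_zero G (U := {x}) (W := P) (by
          intro u hu w hw
          rw [Finset.mem_singleton] at hu
          subst hu
          exact hs.symm.na u hx w hw)] at h1
      linarith
    have hloss := loss G k hk H Q D hs.dq.symm hs.cD
    by_cases hbig : 3 * k ≤ 2 * P.card
    · have hB := ih (P.card + k) (by omega) (P ∪ D) hPD (by omega)
      push_cast at hB
      suffices hh : dd G Q Q + 2 * dd G Q D ≤ 19 / 6 * (k : ℝ) * Q.card by
        rw [hn']; nlinarith
      by_cases hQbig : 3 * k ≤ 2 * Q.card
      · have hs' := dd_sep hs.symm
        have hA := ih (Q.card + k) (by omega) (Q ∪ D) hQD (by omega)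
        push_cast at hA
        rw [dd_union_left G _ hs.dq.symm, dd_union_right G _ hs.dq.symm,
          dd_union_right G _ hs.dq.symm, dd_symm G D Q] at hA
        have : 0 ≤ dd G D D := by
          unfold dd
          exact Finset.sum_nonneg fun _ _ => Finset.sum_nonneg fun _ _ => by
            split_ifs <;> norm_num
        nlinarith
      push Not at hQbig
      have hQb : (Q.card : ℝ) ≤ 3 / 2 * k := by
        have : 2 * (Q.card : ℝ) ≤ 3 * k := by exact_mod_cast hQbig.le
        linarith
      by_cases h76 : (Q.card : ℝ) ≤ 7 / 6 * k
      · nlinarith [mul_nonneg hQ0 (sub_nonneg.2 h76)]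
      · push Not at h76
        have : k + 1 ≤ Q.card := by
          have : (k : ℝ) < Q.card := by linarith
          exact_mod_cast this
        obtain ⟨L, hL1, hL2⟩ := hloss this hdeg
        have := arith_i hk0 h76.le hQb hL2
        nlinarith
    · push Not at hbig
      have hPb : (P.card : ℝ) ≤ 3 / 2 * k := by
        have : 2 * (P.card : ℝ) ≤ 3 * k := by exact_mod_cast hbig.le
        linarith
      have hB := small_bound G k H (P.card + k) (P ∪ D) hPD (by omega)
      push_cast at hB
      have hP0 : (0 : ℝ) ≤ P.card := by positivity
      have hB' : dd G (P ∪ D) (P ∪ D) ≤ ((k : ℝ) + P.card) ^ 2 - 2 / 3 * (P.card : ℝ) ^ 2 := by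
        nlinarith
      rw [hn']
      by_cases hQk : (Q.card : ℝ) ≤ k
      · have := arith_iii (a := Q.card) (b := P.card) hk0 hQ0 hQk (by linarith) hPb
        nlinarith
      · push Not at hQk
        have : k + 1 ≤ Q.card := by exact_mod_cast hQk
        obtain ⟨L, hL1, hL2⟩ := hloss this hdeg
        have := arith_ii hk0 hQk.le hle' hPb hL2
        nlinarith
  obtain ⟨P, D, Q, hs⟩ := exists_sep G k H W (by omega)
  rcases le_total Q.card P.card with h' | h'
  · exact key P D Q hs h'
  · exact key Q D P hs.symm h'

lemma dd_univ (G : SimpleGraph V) :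
    dd G Finset.univ Finset.univ = 2 * ((edgesIn G Finset.univ).card : ℝ) := by
  have h1 : edgesIn G Finset.univ = G.edgeFinset := by
    ext e; simp [edgesIn]
  have h2 := G.sum_degrees_eq_twice_card_edges
  rw [h1]
  have h3 : (2 : ℝ) * (G.edgeFinset.card : ℝ) = ((2 * G.edgeFinset.card : ℕ) : ℝ) := by push_cast; rfl
  rw [h3, ← h2]
  unfold dd
  push_cast
  refine Finset.sum_congr rfl fun v _ => ?_
  rw [Finset.sum_boole, ← SimpleGraph.card_neighborFinset_eq_degree,
    SimpleGraph.neighborFinset_eq_filter]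

/-- Bernshteyn–Kostochka: if `t ≥ 2`, `|V| ≥ (5/2)t` and `|E| > (19/12)t(|V|-t)`,
then `G` has a `(t+1)`-vertex-connected induced subgraph. -/
theorem bernshteyn_kostochka (G : SimpleGraph V) (t : ℕ) (ht : 2 ≤ t)
    (hn : ((5 : ℝ) / 2) * t ≤ (Fintype.card V : ℝ))
    (hm : ((19 : ℝ) / 12) * t * ((Fintype.card V : ℝ) - t) <
      ((edgesIn G Finset.univ).card : ℝ)) :
    ∃ S : Finset V, VertexConnected G S (t + 1) := by
  by_contra H
  have h5 : 5 * t ≤ 2 * Fintype.card V := by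
    have : 5 * (t : ℝ) ≤ 2 * (Fintype.card V : ℝ) := by linarith
    exact_mod_cast this
  have h := main_bound G t ht H (Fintype.card V) Finset.univ Finset.card_univ h5
  rw [dd_univ] at h
  linarith
end
end

section
/- Let G=(V,E) be a finite simple unweighted graph that contains a 2-vertex-connected induced subgraph. Then for every nonempty subset S ⊆ V there exist a subset S' ⊆ V and a positive integer κ with κ ≥ (12/19)·|E(S)|/|S| such that the induced subgraph G[S'] is κ-vertex-connected. -/
open Finset
open scoped Classical

noncomputable section

variable {V : Type*} [Fintype V] [DecidableEq V]

/-- Number of ordered adjacent pairs in `X × Y`. -/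
def nn (G : SimpleGraph V) (X Y : Finset V) : ℤ :=
  ∑ x ∈ X, ∑ y ∈ Y, if G.Adj x y then 1 else 0

lemma nn_nonneg (G : SimpleGraph V) (X Y : Finset V) : 0 ≤ nn G X Y := by
  unfold nn
  refine Finset.sum_nonneg fun x _ => Finset.sum_nonneg fun y _ => ?_
  split_ifs <;> norm_num

lemma nn_comm (G : SimpleGraph V) (X Y : Finset V) : nn G X Y = nn G Y X := by
  unfold nn
  rw [Finset.sum_comm]
  simp only [G.adj_comm]

lemma nn_le (G : SimpleGraph V) (X Y : Finset V) : nn G X Y ≤ (X.card : ℤ) * Y.card := by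
  unfold nn
  calc _ ≤ ∑ x ∈ X, ∑ y ∈ Y, (1 : ℤ) := by
        refine Finset.sum_le_sum fun x _ => Finset.sum_le_sum fun y _ => ?_
        split_ifs <;> norm_num
    _ = _ := by simp

lemma nn_self_le (G : SimpleGraph V) (X : Finset V) :
    nn G X X ≤ (X.card : ℤ) * ((X.card : ℤ) - 1) := by
  unfold nn
  calc _ ≤ ∑ x ∈ X, ((X.card : ℤ) - 1) := by
        refine Finset.sum_le_sum fun x hx => ?_
        rw [← Finset.add_sum_erase X _ hx]
        calc _ ≤ (0 : ℤ) + ∑ y ∈ X.erase x, (1 : ℤ) := by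
              refine add_le_add (by simp) (Finset.sum_le_sum fun y _ => ?_)
              split_ifs <;> norm_num
          _ = _ := by
              have := Finset.card_erase_add_one hx
              simp only [Finset.sum_const, nsmul_eq_mul, mul_one]
              omega
    _ = _ := by simp; ring

lemma nn_union_left (G : SimpleGraph V) {X X' : Finset V} (h : Disjoint X X') (Y : Finset V) :
    nn G (X ∪ X') Y = nn G X Y + nn G X' Y := by
  unfold nn
  exact Finset.sum_union h

lemma nn_union_right (G : SimpleGraph V) {X X' : Finset V} (h : Disjoint X X') (Y : Finset V) :
    nn G Y (X ∪ X') = nn G Y X + nn G Y X' := by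
  rw [nn_comm, nn_union_left G h, nn_comm G Y, nn_comm G Y]

lemma nn_zero (G : SimpleGraph V) {X Y : Finset V} (h : ∀ x ∈ X, ∀ y ∈ Y, ¬ G.Adj x y) :
    nn G X Y = 0 := by
  unfold nn
  refine Finset.sum_eq_zero fun x hx => Finset.sum_eq_zero fun y hy => ?_
  simp [h x hx y hy]

lemma nn_mono (G : SimpleGraph V) {X X' Y Y' : Finset V} (h : X ⊆ X') (h' : Y ⊆ Y') :
    nn G X Y ≤ nn G X' Y' := by
  have h1 : nn G X Y ≤ nn G X' Y := by
    rw [← Finset.union_sdiff_of_subset h, nn_union_left G Finset.disjoint_sdiff]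
    linarith [nn_nonneg G (X' \ X) Y]
  have h2 : nn G X' Y ≤ nn G X' Y' := by
    rw [← Finset.union_sdiff_of_subset h', nn_union_right G Finset.disjoint_sdiff]
    linarith [nn_nonneg G X' (Y' \ Y)]
  linarith

lemma two_card_edgesIn (G : SimpleGraph V) (S : Finset V) :
    2 * ((edgesIn G S).card : ℤ) = nn G S S := by
  let H : SimpleGraph V :=
    { Adj := fun x y => G.Adj x y ∧ x ∈ S ∧ y ∈ S
      symm := ⟨fun x y h => ⟨h.1.symm, h.2.2, h.2.1⟩⟩
      loopless := ⟨fun x h => G.loopless.irrefl x h.1⟩ }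
  have h1 : edgesIn G S = H.edgeFinset := by
    ext e
    induction e using Sym2.ind with
    | _ x y => simp [edgesIn, H]
  have h2 := H.sum_degrees_eq_twice_card_edges
  rw [h1]
  have h3 : ((∑ v, H.degree v : ℕ) : ℤ) = nn G S S := by
    push_cast
    unfold nn
    rw [← Finset.sum_subset (Finset.subset_univ S)]
    · refine Finset.sum_congr rfl fun x hx => ?_
      rw [← SimpleGraph.card_neighborFinset_eq_degree, Finset.sum_boole]
      congr 2
      ext y
      simp [H, hx, and_comm]
    · intro x _ hx
      rw [← SimpleGraph.card_neighborFinset_eq_degree]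
      simp only [Nat.cast_eq_zero, Finset.card_eq_zero]
      ext y
      simp [H, hx]
  rw [← h3, h2]
  push_cast
  rfl

/-- separation lemma -/
lemma exists_sep_s17 (G : SimpleGraph V) (k : ℕ) (S : Finset V) (hS : k + 2 ≤ S.card)
    (h : ¬ VertexConnected G S (k + 1)) :
    ∃ P Z Q : Finset V, P.Nonempty ∧ Q.Nonempty ∧ Z.card = k ∧ Disjoint P Z ∧ Disjoint P Q ∧
      Disjoint Z Q ∧ S = P ∪ Z ∪ Q ∧ ∀ x ∈ P, ∀ y ∈ Q, ¬ G.Adj x y := by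
  unfold VertexConnected at h
  push Not at h
  obtain ⟨D, hDS, hDk, hD⟩ := h (by omega)
  have hne : (S \ D).Nonempty := by
    rw [← Finset.card_pos, Finset.card_sdiff_of_subset hDS]; omega
  have hnp : ¬ (G.induce ((S \ D : Finset V) : Set V)).Preconnected := by
    intro hp
    apply hD
    obtain ⟨w, hw⟩ := hne
    haveI : Nonempty ((S \ D : Finset V) : Set V) := ⟨⟨w, hw⟩⟩
    exact SimpleGraph.Connected.mk hp
  unfold SimpleGraph.Preconnected at hnp
  push Not at hnp
  obtain ⟨u, v, huv⟩ := hnp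
  obtain ⟨u, hu⟩ := u
  obtain ⟨v, hv⟩ := v
  have hu' : u ∈ S \ D := by simpa using hu
  have hv' : v ∈ S \ D := by simpa using hv
  have hne' : u ≠ v := by
    rintro rfl
    exact huv (SimpleGraph.Reachable.refl _)
  rw [Finset.mem_sdiff] at hu' hv'
  have hDsub : D ⊆ (S.erase u).erase v := by
    intro x hx
    simp only [Finset.mem_erase]
    refine ⟨?_, ?_, hDS hx⟩
    · rintro rfl; exact hv'.2 hx
    · rintro rfl; exact hu'.2 hx
  have hcard : ((S.erase u).erase v).card + 2 = S.card := by
    have h1 := Finset.card_erase_add_one hu'.1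
    have h2 := Finset.card_erase_add_one (s := S.erase u) (a := v)
      (Finset.mem_erase.2 ⟨hne'.symm, hv'.1⟩)
    omega
  obtain ⟨Z, hDZ, hZS, hZ⟩ := Finset.exists_subsuperset_card_eq (n := k) hDsub (by omega) (by omega)
  have huZ : u ∉ Z := fun hh => by simpa using hZS hh
  have hvZ : v ∉ Z := fun hh => by simpa using hZS hh
  let R : V → Prop := fun x => ∃ hx : x ∈ ((S \ D : Finset V) : Set V),
    (G.induce ((S \ D : Finset V) : Set V)).Reachable ⟨u, hu⟩ ⟨x, hx⟩
  refine ⟨(S \ Z).filter R, Z, (S \ Z).filter (fun x => ¬ R x), ⟨u, ?_⟩, ⟨v, ?_⟩, hZ, ?_, ?_, ?_,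
    ?_, ?_⟩
  · simp only [Finset.mem_filter, Finset.mem_sdiff]
    exact ⟨⟨hu'.1, huZ⟩, hu, SimpleGraph.Reachable.refl _⟩
  · simp only [Finset.mem_filter, Finset.mem_sdiff]
    exact ⟨⟨hv'.1, hvZ⟩, fun ⟨_, hr⟩ => huv hr⟩
  · rw [Finset.disjoint_left]; intro x hx; simp at hx; exact hx.1.2
  · exact Finset.disjoint_filter_filter_not _ _ _
  · rw [Finset.disjoint_right]; intro x hx; simp at hx; exact hx.1.2
  · ext x
    have : x ∈ Z → x ∈ S := fun hx => Finset.mem_of_mem_erase (Finset.mem_of_mem_erase (hZS hx))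
    simp only [Finset.mem_union, Finset.mem_filter, Finset.mem_sdiff]
    tauto
  · intro x hx y hy hxy
    simp only [Finset.mem_filter, Finset.mem_sdiff] at hx hy
    obtain ⟨_, hxm, hxr⟩ := hx
    apply hy.2
    have hym : y ∈ ((S \ D : Finset V) : Set V) := by
      simp only [Finset.coe_sdiff, Set.mem_diff, Finset.mem_coe]
      exact ⟨hy.1.1, fun hh => hy.1.2 (hDZ hh)⟩
    refine ⟨hym, hxr.trans (SimpleGraph.Adj.reachable ?_)⟩
    exact hxy

/-- expansion of the edge count along a separation -/
lemma nn_sep (G : SimpleGraph V) {P Z Q : Finset V} (h1 : Disjoint P Z) (h2 : Disjoint P Q)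
    (h3 : Disjoint Z Q) (h : ∀ x ∈ P, ∀ y ∈ Q, ¬ G.Adj x y) :
    nn G (P ∪ Z ∪ Q) (P ∪ Z ∪ Q) =
      (nn G P P + 2 * nn G P Z) + (nn G Q Q + 2 * nn G Q Z) + nn G Z Z := by
  have h4 : Disjoint (P ∪ Z) Q := Finset.disjoint_union_left.2 ⟨h2, h3⟩
  have h0 := nn_zero G h
  simp only [nn_union_left G h4, nn_union_right G h4, nn_union_left G h1, nn_union_right G h1]
  rw [nn_comm G Z P, nn_comm G Z Q, nn_comm G Q P, h0]
  ring

lemma nn_two (G : SimpleGraph V) {P Z : Finset V} (h1 : Disjoint P Z) :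
    nn G (P ∪ Z) (P ∪ Z) = (nn G P P + 2 * nn G P Z) + nn G Z Z := by
  simp only [nn_union_left G h1, nn_union_right G h1]
  rw [nn_comm G Z P]
  ring

lemma card_three {P Z Q : Finset V} (h1 : Disjoint P Z) (h2 : Disjoint P Q)
    (h3 : Disjoint Z Q) : (P ∪ Z ∪ Q).card = P.card + Z.card + Q.card := by
  rw [Finset.card_union_of_disjoint (Finset.disjoint_union_left.2 ⟨h2, h3⟩),
    Finset.card_union_of_disjoint h1]

lemma lem_small (G : SimpleGraph V) (k : ℕ) (hG : ∀ S, ¬ VertexConnected G S (k + 1)) :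
    ∀ n : ℕ, ∀ S : Finset V, S.card = n → k ≤ n →
      3 * nn G S S ≤ 3 * k * ((k : ℤ) - 1) + 6 * k * ((n : ℤ) - k) + ((n : ℤ) - k) ^ 2 := by
  intro n
  induction n using Nat.strong_induction_on with
  | _ n ih =>
  intro S hS hk
  by_cases hn : n ≤ k + 1
  · have := nn_self_le G S
    rw [hS] at this
    obtain rfl | rfl : n = k ∨ n = k + 1 := by omega
    · nlinarith
    · push_cast at this ⊢
      nlinarith
  · obtain ⟨P, Z, Q, hP, hQ, hZ, h1, h2, h3, hSe, hno⟩ := exists_sep_s17 G k S (by omega) (hG S)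
    have key : ∀ P Q : Finset V, P.Nonempty → Disjoint P Z → Disjoint P Q → Disjoint Z Q →
        S = P ∪ Z ∪ Q → (∀ x ∈ P, ∀ y ∈ Q, ¬ G.Adj x y) → P.card ≤ Q.card →
        3 * nn G S S ≤ 3 * k * ((k : ℤ) - 1) + 6 * k * ((n : ℤ) - k) + ((n : ℤ) - k) ^ 2 := by
      intro P Q hP h1 h2 h3 hSe hno hle
      have hc := card_three h1 h2 h3
      rw [← hSe] at hc
      have hPc := Finset.card_pos.2 hP
      have hc2 : (Q ∪ Z).card = Q.card + k := by
        rw [Finset.card_union_of_disjoint h3.symm, hZ]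
      have := ih (Q.card + k) (by omega) (Q ∪ Z) hc2 (by omega)
      rw [nn_two G h3.symm] at this
      rw [hSe, nn_sep G h1 h2 h3 hno]
      have e1 := nn_self_le G P
      have e2 := nn_le G P Z
      rw [hZ] at e2
      have hn : (n : ℤ) = P.card + k + Q.card := by omega
      rw [hn]
      push_cast at this
      have hle' : (P.card : ℤ) ≤ Q.card := by exact_mod_cast hle
      have hp0 : (0 : ℤ) ≤ P.card := by positivity
      nlinarith [mul_le_mul_of_nonneg_left hle' hp0]
    rcases le_total P.card Q.card with hle | hle
    · exact key P Q hP h1 h2 h3 hSe hno hle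
    · refine key Q P hQ h3.symm h2.symm h1.symm ?_ (fun x hx y hy hxy => hno y hy x hx hxy.symm) hle
      rw [hSe]; ext x; simp only [Finset.mem_union]; tauto

lemma arith_missing (p q r s u T k : ℤ) (hp : 0 ≤ p) (hq : 0 ≤ q) (hr : 0 ≤ r) (hs : 0 ≤ s)
    (hT : T ≤ k) (ht : k ≤ 2 * T) (hsum : p + q + r + s = u + T) (hqs : q + s ≤ T)
    (h1 : 2 * T - k ≤ 2 * (p + q)) (h2 : 2 * T - k ≤ 2 * (r + s)) :
    u * (2 * T - k) ≤ 2 * (p * r + p * s + q * r) := by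
  obtain ⟨t, ht'⟩ : ∃ t, t = 2 * T - k := ⟨_, rfl⟩
  rw [← ht'] at h1 h2 ⊢
  have hprod : 0 ≤ (2 * (p + q) - t) * (2 * (r + s) - t) :=
    mul_nonneg (by linarith) (by linarith)
  by_cases hq' : t ≤ 2 * q
  · by_cases hs' : t ≤ 2 * s
    · nlinarith [mul_nonneg hp (sub_nonneg.2 hs'), mul_nonneg hr (sub_nonneg.2 hq'),
        mul_nonneg hp hr, mul_nonneg (show 0 ≤ t by linarith) (sub_nonneg.2 hqs)]
    · have a1 : 0 ≤ s * (T - q - s) := mul_nonneg hs (by linarith)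
      have a2 : 0 ≤ (t - 2 * s) * (2 * T - t - 2 * s) := mul_nonneg (by linarith) (by linarith)
      have hu : u = p + q + r + s - T := by linarith
      subst hu
      nlinarith
  · have a1 : 0 ≤ q * (T - q - s) := mul_nonneg hq (by linarith)
    have a2 : 0 ≤ (t - 2 * q) * (2 * T - t - 2 * q) := mul_nonneg (by linarith) (by linarith)
    have hu : u = p + q + r + s - T := by linarith
    subst hu
    nlinarith

lemma split_three {P Z Q X : Finset V} (h : X ⊆ P ∪ Z ∪ Q) :
    X = (X ∩ P) ∪ (X ∩ Z) ∪ (X ∩ Q) := by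
  rw [← Finset.inter_union_distrib_left, ← Finset.inter_union_distrib_left]
  exact (Finset.inter_eq_left.2 h).symm

lemma nn_sep_cross (G : SimpleGraph V) {P Z Q P' Z' Q' : Finset V}
    (h1 : Disjoint P Z) (h2 : Disjoint P Q) (h3 : Disjoint Z Q)
    (h1' : Disjoint P' Z') (h2' : Disjoint P' Q') (h3' : Disjoint Z' Q')
    (h : ∀ x ∈ P, ∀ y ∈ Q', ¬ G.Adj x y) (h' : ∀ x ∈ Q, ∀ y ∈ P', ¬ G.Adj x y) :
    nn G (P ∪ Z ∪ Q) (P' ∪ Z' ∪ Q') =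
      nn G P P' + nn G P Z' + nn G Z P' + nn G Z Z' + nn G Z Q' + nn G Q Z' + nn G Q Q' := by
  have h4 : Disjoint (P ∪ Z) Q := Finset.disjoint_union_left.2 ⟨h2, h3⟩
  have h4' : Disjoint (P' ∪ Z') Q' := Finset.disjoint_union_left.2 ⟨h2', h3'⟩
  have h0 := nn_zero G h
  have h0' := nn_zero G h'
  simp only [nn_union_left G h4, nn_union_right G h4', nn_union_left G h1, nn_union_right G h1']
  rw [h0, h0']
  ring

lemma lem_missing (G : SimpleGraph V) (k : ℕ) (hG : ∀ S, ¬ VertexConnected G S (k + 1))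
    (A : Finset V) (hA : k + 1 ≤ A.card) :
    ∀ m : ℕ, ∀ T : Finset V, T.card = m → m ≤ k → Disjoint A T →
      (∀ v ∈ A, (k : ℤ) + 2 * m ≤ 2 * nn G {v} (A ∪ T)) →
      nn G A A + 2 * nn G A T ≤ (A.card : ℤ) * (A.card - 1) + 2 * A.card * m
        - ((A.card : ℤ) - k) * (2 * m - k) := by
  intro m
  induction m using Nat.strong_induction_on with
  | _ m ih =>
  intro T hT hmk hAT hdeg
  have hA' : (k : ℤ) + 1 ≤ A.card := by exact_mod_cast hA
  by_cases hm : 2 * m ≤ k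
  · have e1 := nn_self_le G A
    have e2 := nn_le G A T
    rw [hT] at e2
    have hm' : 2 * (m : ℤ) ≤ k := by exact_mod_cast hm
    nlinarith [mul_nonneg (show 0 ≤ (A.card : ℤ) - k by linarith) (sub_nonneg.2 hm')]
  have hAc : (A ∪ T).card = A.card + m := by rw [Finset.card_union_of_disjoint hAT, hT]
  obtain ⟨P, Z, Q, hP, hQ, hZ, h1, h2, h3, hSe, hno⟩ :=
    exists_sep_s17 G k (A ∪ T) (by omega) (hG _)
  -- peeling
  have peel : ∀ P Q : Finset V, P.Nonempty → Disjoint P Z → Disjoint P Q → Disjoint Z Q →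
        A ∪ T = P ∪ Z ∪ Q → (∀ x ∈ P, ∀ y ∈ Q, ¬ G.Adj x y) → A ∩ P = ∅ →
        nn G A A + 2 * nn G A T ≤ (A.card : ℤ) * (A.card - 1) + 2 * A.card * m
        - ((A.card : ℤ) - k) * (2 * m - k) := by
    intro P Q hP h1 h2 h3 hSe hno hAP
    have hAP' : Disjoint A P := Finset.disjoint_iff_inter_eq_empty.2 hAP
    have hPT : P ⊆ T := by
      intro x hx
      have : x ∈ A ∪ T := by rw [hSe]; simp [hx]
      rcases Finset.mem_union.1 this with h | h
      · exact absurd hx (Finset.disjoint_left.1 hAP' h)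
      · exact h
    have hPc := Finset.card_pos.2 hP
    have hc : (T \ P).card + P.card = m := by rw [Finset.card_sdiff_add_card_eq_card hPT, hT]
    have hd : Disjoint (T \ P) P := Finset.sdiff_disjoint
    have hTe : T = (T \ P) ∪ P := (Finset.sdiff_union_of_subset hPT).symm
    have hcz : (m : ℤ) = (T \ P).card + P.card := by exact_mod_cast hc.symm
    have hI := ih (T \ P).card (by omega) (T \ P) rfl (by omega)
      (hAT.mono_right Finset.sdiff_subset) (by
        intro v hv
        have hh := hdeg v hv
        have e : A ∪ T = (A ∪ (T \ P)) ∪ P := by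
          rw [Finset.union_assoc, ← hTe]
        rw [e, nn_union_right G (Finset.disjoint_union_left.2 ⟨hAP', hd⟩)] at hh
        have := nn_le G {v} P
        simp only [Finset.card_singleton, Nat.cast_one, one_mul] at this
        linarith)
    have e1 : nn G A T = nn G A (T \ P) + nn G A P := by
      conv_lhs => rw [hTe]
      exact nn_union_right G hd A
    have e2 : nn G A P ≤ (k : ℤ) * P.card := by
      have hs : A ⊆ Z ∪ Q := by
        intro x hx
        have : x ∈ P ∪ Z ∪ Q := by rw [← hSe]; simp [hx]
        have hxP := Finset.disjoint_left.1 hAP' hx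
        simp only [Finset.mem_union] at this ⊢
        tauto
      calc nn G A P ≤ nn G (Z ∪ Q) P := nn_mono G hs (Finset.Subset.refl _)
        _ = nn G Z P + nn G Q P := nn_union_left G h3 P
        _ = nn G Z P := by rw [nn_comm G Q P, nn_zero G hno, add_zero]
        _ ≤ _ := by have := nn_le G Z P; rwa [hZ] at this
    rw [e1, hcz]
    nlinarith
  by_cases hAP : A ∩ P = ∅
  · exact peel P Q hP h1 h2 h3 hSe hno hAP
  by_cases hAQ : A ∩ Q = ∅
  · refine peel Q P hQ h3.symm h2.symm h1.symm ?_ (fun x hx y hy hxy => hno y hy x hx hxy.symm) hAQ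
    rw [hSe]; ext x; simp only [Finset.mem_union]; tauto
  -- main case
  have big : ∀ P Q : Finset V, Disjoint P Z → Disjoint P Q → Disjoint Z Q →
        A ∪ T = P ∪ Z ∪ Q → (∀ x ∈ P, ∀ y ∈ Q, ¬ G.Adj x y) → A ∩ P ≠ ∅ →
        2 * (m : ℤ) - k ≤ 2 * P.card := by
    intro P Q h1 h2 h3 hSe hno hAP
    obtain ⟨v, hv⟩ := Finset.nonempty_iff_ne_empty.2 hAP
    rw [Finset.mem_inter] at hv
    have hh := hdeg v hv.1
    rw [hSe, nn_union_right G (Finset.disjoint_union_left.2 ⟨h2, h3⟩), nn_union_right G h1,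
      nn_zero G (X := {v}) (Y := Q) (by intro x hx y hy; rw [Finset.mem_singleton] at hx; subst hx
                                        exact hno _ hv.2 y hy)] at hh
    have e1 := nn_le G {v} P
    have e2 := nn_le G {v} Z
    simp only [Finset.card_singleton, Nat.cast_one, one_mul, hZ] at e1 e2
    linarith
  have b1 := big P Q h1 h2 h3 hSe hno hAP
  have b2 := big Q P h3.symm h2.symm h1.symm (by
    rw [hSe]; ext x; simp only [Finset.mem_union]; tauto)
    (fun x hx y hy hxy => hno y hy x hx hxy.symm) hAQ
  have hAs : A = (A ∩ P) ∪ (A ∩ Z) ∪ (A ∩ Q) :=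
    split_three (by rw [← hSe]; exact Finset.subset_union_left)
  have hTs : T = (T ∩ P) ∪ (T ∩ Z) ∪ (T ∩ Q) :=
    split_three (by rw [← hSe]; exact Finset.subset_union_right)
  have dd : ∀ {X Y : Finset V} (W : Finset V), Disjoint X Y → Disjoint (W ∩ X) (W ∩ Y) :=
    fun W h => h.mono Finset.inter_subset_right Finset.inter_subset_right
  have no1 : ∀ W W' : Finset V, ∀ x ∈ W ∩ P, ∀ y ∈ W' ∩ Q, ¬ G.Adj x y := fun W W' x hx y hy =>
    hno x (Finset.mem_inter.1 hx).2 y (Finset.mem_inter.1 hy).2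
  have no2 : ∀ W W' : Finset V, ∀ x ∈ W ∩ Q, ∀ y ∈ W' ∩ P, ¬ G.Adj x y :=
    fun W W' x hx y hy hxy => no1 W' W y hy x hx hxy.symm
  have cA := card_three (dd A h1) (dd A h2) (dd A h3)
  rw [← hAs] at cA
  have cT := card_three (dd T h1) (dd T h2) (dd T h3)
  rw [← hTs, hT] at cT
  have sub : ∀ X : Finset V, X ⊆ A ∪ T → X.card = (A ∩ X).card + (T ∩ X).card := by
    intro X hX
    rw [← Finset.card_union_of_disjoint
      (hAT.mono Finset.inter_subset_left Finset.inter_subset_left),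
      ← Finset.union_inter_distrib_right, Finset.inter_eq_right.2 hX]
  have cP := sub P (by rw [hSe]; intro x hx; simp [hx])
  have cQ := sub Q (by rw [hSe]; intro x hx; simp [hx])
  have cZ := sub Z (by rw [hSe]; intro x hx; simp [hx])
  rw [hZ] at cZ
  have eA := nn_sep_cross G (dd A h1) (dd A h2) (dd A h3) (dd A h1) (dd A h2) (dd A h3)
    (no1 A A) (no2 A A)
  have eT := nn_sep_cross G (dd A h1) (dd A h2) (dd A h3) (dd T h1) (dd T h2) (dd T h3)
    (no1 A T) (no2 A T)
  rw [← hAs] at eA eT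
  rw [← hTs] at eT
  have f1 := nn_self_le G (A ∩ P)
  have f2 := nn_self_le G (A ∩ Z)
  have f3 := nn_self_le G (A ∩ Q)
  have f4 := nn_le G (A ∩ P) (A ∩ Z)
  have f5 := nn_le G (A ∩ Z) (A ∩ P)
  have f6 := nn_le G (A ∩ Q) (A ∩ Z)
  have f7 := nn_le G (A ∩ Z) (A ∩ Q)
  have g1 := nn_le G (A ∩ P) (T ∩ P)
  have g2 := nn_le G (A ∩ Z) (T ∩ Z)
  have g3 := nn_le G (A ∩ Q) (T ∩ Q)
  have g4 := nn_le G (A ∩ P) (T ∩ Z)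
  have g5 := nn_le G (A ∩ Z) (T ∩ P)
  have g6 := nn_le G (A ∩ Q) (T ∩ Z)
  have g7 := nn_le G (A ∩ Z) (T ∩ Q)
  have ar := arith_missing (A ∩ P).card (T ∩ P).card (A ∩ Q).card (T ∩ Q).card
    ((A.card : ℤ) - k) m k (Int.natCast_nonneg _) (Int.natCast_nonneg _) (Int.natCast_nonneg _) (Int.natCast_nonneg _)
    (by omega) (by omega) (by omega) (by omega) (by omega) (by omega)
  rw [eA, eT]
  have cA' : (A.card : ℤ) = (A ∩ P).card + (A ∩ Z).card + (A ∩ Q).card := by exact_mod_cast cA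
  have cT' : (m : ℤ) = (T ∩ P).card + (T ∩ Z).card + (T ∩ Q).card := by exact_mod_cast cT
  have h5 : (A.card : ℤ) * (A.card - 1) + 2 * A.card * m =
    ((A ∩ P).card + (A ∩ Z).card + (A ∩ Q).card : ℤ) *
      (((A ∩ P).card + (A ∩ Z).card + (A ∩ Q).card : ℤ) - 1) +
    2 * ((A ∩ P).card + (A ∩ Z).card + (A ∩ Q).card : ℤ) *
      ((T ∩ P).card + (T ∩ Z).card + (T ∩ Q).card : ℤ) := by rw [← cA', ← cT']
  rw [h5]
  linarith

lemma lem_main (G : SimpleGraph V) (k : ℕ) (hk : 1 ≤ k)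
    (hG : ∀ S, ¬ VertexConnected G S (k + 1)) :
    ∀ n : ℕ, ∀ S : Finset V, S.card = n → 5 * k ≤ 2 * n →
      6 * nn G S S ≤ 19 * k * ((n : ℤ) - k) := by
  intro n
  induction n using Nat.strong_induction_on with
  | _ n ih =>
  intro S hS hkn
  by_cases hn : n ≤ 3 * k
  · have := lem_small G k hG n S hS (by omega)
    have h1 : 0 ≤ (2 * (n : ℤ) - 5 * k) := by omega
    have h2 : 0 ≤ (3 * (k : ℤ) - n) := by omega
    nlinarith [mul_nonneg h1 h2]
  by_cases hmin : ∃ v ∈ S, 12 * nn G {v} S ≤ 19 * k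
  · obtain ⟨v, hv, hd⟩ := hmin
    have hI := ih (n - 1) (by omega) (S.erase v) (by rw [Finset.card_erase_of_mem hv, hS])
      (by omega)
    have hSe : S = {v} ∪ S.erase v := by
      rw [← Finset.insert_eq, Finset.insert_erase hv]
    have hdis : Disjoint {v} (S.erase v) := by simp
    have e := nn_two G hdis
    rw [← hSe] at e
    have e2 : nn G {v} (S.erase v) ≤ nn G {v} S :=
      nn_mono G (Finset.Subset.refl _) (Finset.erase_subset _ _)
    have e3 := nn_self_le G {v}
    simp only [Finset.card_singleton, Nat.cast_one, sub_self, mul_zero] at e3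
    have : ((n - 1 : ℕ) : ℤ) = n - 1 := by omega
    rw [this] at hI
    nlinarith
  push Not at hmin
  obtain ⟨P, Z, Q, hP, hQ, hZ, h1, h2, h3, hSe, hno⟩ := exists_sep_s17 G k S (by omega) (hG S)
  -- edges touching a side
  have side : ∀ P Q : Finset V, Disjoint P Z → Disjoint P Q → Disjoint Z Q →
      S = P ∪ Z ∪ Q → (∀ x ∈ P, ∀ y ∈ Q, ¬ G.Adj x y) → k ≤ P.card →
      nn G P P + 2 * nn G P Z ≤ (P.card : ℤ) * (P.card - 1) + 2 * P.card * k
        - ((P.card : ℤ) - k) * k := by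
    intro P Q h1 h2 h3 hSe hno hkP
    rcases hkP.eq_or_lt with he | hlt
    · have e1 := nn_self_le G P
      have e2 := nn_le G P Z
      rw [hZ] at e2
      have he' : (P.card : ℤ) = k := by exact_mod_cast he.symm
      rw [he'] at e1 e2 ⊢
      nlinarith
    · have := lem_missing G k hG P hlt k Z hZ le_rfl h1 (by
        intro v hv
        have hh := hmin v (by rw [hSe]; simp [hv])
        rw [hSe, nn_union_right G (Finset.disjoint_union_left.2 ⟨h2, h3⟩),
          nn_zero G (X := {v}) (Y := Q) (by
            intro x hx y hy; rw [Finset.mem_singleton] at hx; subst hx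
            exact hno _ hv y hy)] at hh
        linarith)
      nlinarith
  have key : ∀ P Q : Finset V, P.Nonempty → Disjoint P Z → Disjoint P Q → Disjoint Z Q →
        S = P ∪ Z ∪ Q → (∀ x ∈ P, ∀ y ∈ Q, ¬ G.Adj x y) → P.card ≤ Q.card →
        6 * nn G S S ≤ 19 * k * ((n : ℤ) - k) := by
    intro P Q hP h1 h2 h3 hSe hno hle
    have hSe' : S = Q ∪ Z ∪ P := by
      rw [hSe]; ext x; simp only [Finset.mem_union]; tauto
    have hno' : ∀ x ∈ Q, ∀ y ∈ P, ¬ G.Adj x y := fun x hx y hy hxy => hno y hy x hx hxy.symm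
    have sP := side P Q h1 h2 h3 hSe hno
    have sQ := side Q P h3.symm h2.symm h1.symm hSe' hno'
    have hc := card_three h1 h2 h3
    rw [← hSe, hS, hZ] at hc
    have hPc := Finset.card_pos.2 hP
    have cQ : (Q ∪ Z).card = Q.card + k := by
      rw [Finset.card_union_of_disjoint h3.symm, hZ]
    have cP : (P ∪ Z).card = P.card + k := by
      rw [Finset.card_union_of_disjoint h1, hZ]
    have tQ := nn_two G h3.symm
    have tP := nn_two G h1
    have lQ := lem_small G k hG _ (Q ∪ Z) cQ (by omega)
    have lP := lem_small G k hG _ (P ∪ Z) cP (by omega)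
    have iQ := ih _ (by omega) (Q ∪ Z) cQ
    have iP := ih _ (by omega) (P ∪ Z) cP
    have hZ0 := nn_nonneg G Z Z
    have e1 := nn_self_le G P
    have e2 := nn_le G P Z
    rw [hZ] at e2
    have eP : nn G P P + 2 * nn G P Z ≤ (P.card : ℤ) * (P.card - 1) + 2 * (P.card * k) := by linarith
    clear e1 e2
    have hT := nn_sep G h1 h2 h3 hno
    rw [← hSe] at hT
    rw [tQ] at lQ iQ
    rw [tP] at lP iP
    have hnz : (n : ℤ) = P.card + k + Q.card := by exact_mod_cast hc
    rw [hT, hnz]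
    have hk' : (1 : ℤ) ≤ k := by exact_mod_cast hk
    push_cast at lQ lP iQ iP
    have hn' : 2 * (k : ℤ) < P.card + Q.card := by omega
    have hle' : (P.card : ℤ) ≤ Q.card := by exact_mod_cast hle
    have hP1 : (1 : ℤ) ≤ P.card := by exact_mod_cast hPc
    have sP' : (k : ℤ) ≤ P.card → _ := fun h => sP (by exact_mod_cast h)
    have sQ' : (k : ℤ) ≤ Q.card → _ := fun h => sQ (by exact_mod_cast h)
    have iQ' : 3 * (k : ℤ) ≤ 2 * Q.card → _ := fun h => iQ (by omega)
    have iP' : 3 * (k : ℤ) ≤ 2 * P.card → _ := fun h => iP (by omega)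
    clear sP sQ iP iQ hT hnz
    generalize (P.card : ℤ) = a at *
    generalize (Q.card : ℤ) = b at *
    generalize (k : ℤ) = κ at *
    generalize nn G P P + 2 * nn G P Z = EP at *
    by_cases hb : 3 * κ ≤ 2 * b
    · have i1 := iQ' hb
      by_cases ha : 3 * κ ≤ 2 * a
      · have i2 := iP' ha
        linarith
      · by_cases hak : κ ≤ a
        · have i2 := sP' hak
          nlinarith [mul_nonneg (show 0 ≤ 3 * κ - 2 * a by linarith)
            (show 0 ≤ 3 * a - 2 * κ by linarith)]
        · nlinarith [mul_nonneg (show 0 ≤ a by linarith) (show 0 ≤ κ - a by linarith),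
            mul_nonneg (show 0 ≤ a by linarith) (show 0 ≤ κ by linarith)]
    · by_cases hak : κ ≤ a
      · have i1 := sP' hak
        have i2 := sQ' (by linarith)
        nlinarith [mul_nonneg (show 0 ≤ 3 * κ - 2 * a by linarith)
            (show 0 ≤ a - κ by linarith), mul_nonneg (show 0 ≤ 3 * κ - 2 * b by linarith)
            (show 0 ≤ b - κ by linarith)]
      · nlinarith [mul_nonneg (show 0 ≤ b - 2 * κ + a by linarith)
            (show 0 ≤ 3 * κ - 2 * b + 2 * a by linarith),
            mul_nonneg (show 0 ≤ a by linarith) (show 0 ≤ κ - a by linarith)]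
  rcases le_total P.card Q.card with hle | hle
  · exact key P Q hP h1 h2 h3 hSe hno hle
  · refine key Q P hQ h3.symm h2.symm h1.symm ?_ (fun x hx y hy hxy => hno y hy x hx hxy.symm) hle
    rw [hSe]; ext x; simp only [Finset.mem_union]; tauto

theorem highly_connected_subgraph_exists (G : SimpleGraph V)
    (h2 : ∃ T : Finset V, VertexConnected G T 2) :
    ∀ S : Finset V, S.Nonempty →
      ∃ (S' : Finset V) (κ : ℕ), 0 < κ ∧
        ((12 : ℝ) / 19) * (((edgesIn G S).card : ℝ) / (S.card : ℝ)) ≤ (κ : ℝ) ∧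
        VertexConnected G S' κ := by
  intro S hS
  have hSc := Finset.card_pos.2 hS
  have hScR : (0 : ℝ) < S.card := by exact_mod_cast hSc
  set y : ℝ := ((12 : ℝ) / 19) * (((edgesIn G S).card : ℝ) / (S.card : ℝ)) with hy
  by_cases hy1 : y ≤ 1
  · obtain ⟨T, hT1, hT2⟩ := h2
    exact ⟨T, 1, one_pos, by simpa using hy1, by omega, fun D hD hc => hT2 D hD (by omega)⟩
  push Not at hy1
  have hc1 : 1 < ⌈y⌉₊ := Nat.lt_ceil.2 (by simpa using hy1)
  obtain ⟨k, hk⟩ : ∃ k, ⌈y⌉₊ = k + 1 := ⟨⌈y⌉₊ - 1, by omega⟩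
  by_contra hcon
  push Not at hcon
  have hG : ∀ S', ¬ VertexConnected G S' (k + 1) := by
    intro S'
    refine hcon S' (k + 1) (by omega) ?_
    rw [← hk]
    exact Nat.le_ceil y
  have hky : (k : ℝ) < y := Nat.lt_ceil.1 (by omega)
  have hE : 19 * (k : ℝ) * S.card < 12 * (edgesIn G S).card := by
    have : y * S.card = 12 / 19 * (edgesIn G S).card := by
      rw [hy]; field_simp
    nlinarith
  have hE' : 19 * (k : ℤ) * S.card < 12 * (edgesIn G S).card := by exact_mod_cast hE
  have h2e := two_card_edgesIn G S
  have hle := nn_self_le G S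
  have hn0 : (0 : ℤ) < S.card := by exact_mod_cast hSc
  have hkn : 19 * (k : ℤ) < 6 * (S.card - 1) := by
    by_contra hh
    push Not at hh
    nlinarith [mul_le_mul_of_nonneg_left hh hn0.le]
  have := lem_main G k (by omega) hG S.card S rfl (by omega)
  nlinarith [mul_self_nonneg (k : ℤ)]
end
end
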